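/- For each integer l ≥ 1 define r_l : (0,1) → ℝ by r_l(t) = (1/l)·sin(l²πt), and set a_l = ∫₀¹ r_l(t)² dt and b_l = ∫₀¹ (r_l'(t))² dt, where r_l'(t) = lπ·cos(l²πt). Then the sequence (2 a_l b_l + a_l²)_{l≥1} (the squared norm ‖r_l⊗r_l‖_V² for the H¹((0,1)×(0,1))-type norm ‖r⊗s‖_V² = ‖r‖²_{L²}‖s'‖²_{L²} + ‖r'‖²_{L²}‖s‖²_{L²} + ‖r‖²_{L²}‖s‖²_{L²}) is bounded, while the sequence (a_l + b_l)_{l≥1} (the product ‖r_l‖_{H¹}·‖r_l‖_{H¹} of squared-root H¹-norms, i.e. ‖r_l‖²_{H¹(0,1)}) tends to +∞. Consequently the H¹((0,1)²)-norm restricted to tensor products is not equivalent to the cross-norm ‖r‖_{H¹(0,1)}‖s‖_{H¹(0,1)}. -/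

import Mathlib

open Real in
theorem integral_sin_nat_mul_pi_sq {n : ℕ} (hn : n ≠ 0) :
    ∫ t in (0:ℝ)..1, sin (n * π * t) ^ 2 = 1 / 2 := by
  have hc : (n : ℝ) * π ≠ 0 := mul_ne_zero (Nat.cast_ne_zero.mpr hn) pi_ne_zero
  rw [intervalIntegral.integral_comp_mul_left (fun x => sin x ^ 2) hc, integral_sin_sq]
  simp only [mul_zero, mul_one, sin_zero, sin_nat_mul_pi, smul_eq_mul]
  field_simp
  ring

open Real in
theorem integral_cos_nat_mul_pi_sq {n : ℕ} (hn : n ≠ 0) :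
    ∫ t in (0:ℝ)..1, cos (n * π * t) ^ 2 = 1 / 2 := by
  have hc : (n : ℝ) * π ≠ 0 := mul_ne_zero (Nat.cast_ne_zero.mpr hn) pi_ne_zero
  rw [intervalIntegral.integral_comp_mul_left (fun x => cos x ^ 2) hc, integral_cos_sq]
  simp only [mul_zero, mul_one, sin_zero, sin_nat_mul_pi, smul_eq_mul]
  field_simp
  ring

/-- **Remark 2.5.** With `r_l(t) = (1/l) sin(l²πt)` on `(0,1)`, `a_l = ‖r_l‖²_{L²}` and
`b_l = ‖r_l'‖²_{L²}`, the squared `H¹((0,1)²)`-norms `2 a_l b_l + a_l²` of `r_l ⊗ r_l` are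
bounded, while the squared cross-norms `a_l + b_l = ‖r_l‖²_{H¹}` tend to `+∞`; consequently
the `H¹((0,1)²)`-norm on tensor products is not equivalent to the cross-norm
`‖r‖_{H¹} ‖s‖_{H¹}`. -/
theorem stmt_18
    (a b : ℕ → ℝ)
    (ha : ∀ l : ℕ, 1 ≤ l →
      a l = ∫ t in (0:ℝ)..1, ((1 / (l : ℝ)) * Real.sin ((l : ℝ) ^ 2 * Real.pi * t)) ^ 2)
    (hb : ∀ l : ℕ, 1 ≤ l →
      b l = ∫ t in (0:ℝ)..1, ((l : ℝ) * Real.pi * Real.cos ((l : ℝ) ^ 2 * Real.pi * t)) ^ 2) :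
    (∃ C : ℝ, ∀ l : ℕ, 1 ≤ l → 2 * a l * b l + (a l) ^ 2 ≤ C) ∧
    Filter.Tendsto (fun l : ℕ => a l + b l) Filter.atTop Filter.atTop ∧
    ¬ ∃ c : ℝ, ∀ l : ℕ, 1 ≤ l →
      a l + b l ≤ c * Real.sqrt (2 * a l * b l + (a l) ^ 2) := by
  have ha' : ∀ l : ℕ, 1 ≤ l → a l = 1 / (2 * (l : ℝ) ^ 2) := by
    intro l hl
    have h := integral_sin_nat_mul_pi_sq (n := l ^ 2) (by positivity)
    push_cast at h
    simp_rw [ha l hl, mul_pow _ (Real.sin _)]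
    rw [intervalIntegral.integral_const_mul, h]
    ring
  have hb' : ∀ l : ℕ, 1 ≤ l → b l = (l : ℝ) ^ 2 * Real.pi ^ 2 / 2 := by
    intro l hl
    have h := integral_cos_nat_mul_pi_sq (n := l ^ 2) (by positivity)
    push_cast at h
    simp_rw [hb l hl, mul_pow _ (Real.cos _)]
    rw [intervalIntegral.integral_const_mul, h]
    ring
  have hbound : ∀ l : ℕ, 1 ≤ l → 2 * a l * b l + (a l) ^ 2 ≤ Real.pi ^ 2 / 2 + 1 := by
    intro l hl
    have hl' : (1 : ℝ) ≤ l := by exact_mod_cast hl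
    have hab : 2 * a l * b l = Real.pi ^ 2 / 2 := by
      rw [ha' l hl, hb' l hl]
      field_simp
    have ha_nonneg : 0 ≤ a l := by
      rw [ha' l hl]
      positivity
    have ha_le : a l ≤ 1 := by
      rw [ha' l hl, div_le_one (by positivity)]
      nlinarith
    rw [hab]
    gcongr
    exact pow_le_one₀ ha_nonneg ha_le
  have htend : Filter.Tendsto (fun l : ℕ => a l + b l) Filter.atTop Filter.atTop := by
    refine Filter.tendsto_atTop_mono' _ ?_ tendsto_natCast_atTop_atTop
    filter_upwards [Filter.eventually_ge_atTop 1] with l hl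
    have hl' : (1 : ℝ) ≤ l := by exact_mod_cast hl
    have ha_nonneg : 0 ≤ a l := by
      rw [ha' l hl]
      positivity
    have hpi : 2 ≤ Real.pi ^ 2 := by nlinarith [Real.pi_gt_three]
    rw [hb' l hl]
    nlinarith [mul_le_mul_of_nonneg_left hpi (sq_nonneg (l : ℝ))]
  refine ⟨⟨_, hbound⟩, htend, ?_⟩
  rintro ⟨c, hc⟩
  obtain ⟨l, hlarge, hl⟩ := ((htend.eventually_gt_atTop
    (|c| * Real.sqrt (Real.pi ^ 2 / 2 + 1))).and (Filter.eventually_ge_atTop 1)).exists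
  refine hlarge.not_ge ((hc l hl).trans ?_)
  exact mul_le_mul (le_abs_self c) (Real.sqrt_le_sqrt (hbound l hl)) (Real.sqrt_nonneg _)
    (abs_nonneg c)
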